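/- arXiv:1007.1289 — 2 statements merged into one kernel-verified Lean document; each statement's English description precedes it below -/
import Mathlib

section
/- Let a > b ≥ 1 be integers with a − b odd, let n = a + b and m = (a − b − 1)/2. Define ρ, τ : Fin n → ℤ by ρ_i = (n−1)/2 − i and τ_i = max(m − i, 0) − max(i − m − 2b, 0) for 0 ≤ i ≤ n−1. For a weakly decreasing sequence of natural numbers α₁ ≥ α₂ ≥ ... ≥ α_b ≥ 0, define μ : Fin n → ℤ by μ_i = α_{i+1} for 0 ≤ i ≤ b−1, μ_i = 0 for b ≤ i ≤ a−1, and μ_i = −α_{n−i} for a ≤ i ≤ n−1. Then there exists a permutation σ of Fin n such that (μ − ρ)_i = τ_{σ(i)} for all i if and only if α_j = (a+b+1)/2 − j for all 1 ≤ j ≤ b. -/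
/-- Combinatorial core of the computation of the Dirac cohomology of the spherical
unipotent representation of `GL(a+b, ℂ)` attached to the partition `(a, b)`.
Here `ρ` is the half-sum of positive roots of `gl(a+b)`, `τ = 2λ − ρ` is the
prescribed highest weight of the Dirac cohomology, `μ` ranges over the highest
weights of the `K`-types of the representation induced from the trivial character
of `GL(a) × GL(b)`, and the Weyl group of type `A` acts by permutations. -/
theorem stmt12 (a b : ℕ) (hb : 1 ≤ b) (hab : b < a) (hodd : Odd (a - b))
    (n : ℕ) (hn : n = a + b) (m : ℕ) (hm : m = (a - b - 1) / 2)
    (α : Fin b → ℕ) (hα : ∀ i j : Fin b, i ≤ j → α j ≤ α i)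
    (ρ τ μ : Fin n → ℤ)
    (hρ : ∀ i : Fin n, ρ i = ((n : ℤ) - 1) / 2 - (i : ℕ))
    (hτ : ∀ i : Fin n, τ i = max ((m : ℤ) - (i : ℕ)) 0 - max (((i : ℕ) : ℤ) - m - 2 * b) 0)
    (hμ : ∀ i : Fin n, μ i =
      if h : (i : ℕ) < b then (α ⟨(i : ℕ), h⟩ : ℤ)
      else if h' : (i : ℕ) < a then 0
      else -(α ⟨n - 1 - (i : ℕ), by have := i.isLt; omega⟩ : ℤ)) :
    (∃ σ : Equiv.Perm (Fin n), ∀ i : Fin n, μ i - ρ i = τ (σ i)) ↔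
      ∀ j : Fin b, (α j : ℤ) = ((a : ℤ) + b + 1) / 2 - ((j : ℕ) + 1) := by
  obtain ⟨rfl, rfl⟩ : a = b + 2 * m + 1 ∧ n = 2 * b + 2 * m + 1 := by
    obtain ⟨k, hk⟩ := hodd
    omega
  have hρ' (i : Fin (2 * b + 2 * m + 1)) : ρ i = (b : ℤ) + m - (i : ℕ) := by
    rw [hρ]
    omega
  constructor
  · rintro ⟨σ, hσ⟩ j
    by_contra hne
    have hj := j.isLt
    have hμj := hμ ⟨j, by omega⟩
    rw [dif_pos hj, Fin.eta] at hμj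
    have hσj := hσ ⟨j, by omega⟩
    rw [hμj, hρ', hτ] at hσj
    simp only at hσj
    have hs := (σ ⟨j, by omega⟩).isLt
    -- A nonzero value `v = α j + j - (b + m)` of `τ` is also attained at the middle index `b + m + v`.
    obtain ⟨k, hk⟩ : ∃ k : ℕ, (k : ℤ) = (α j : ℤ) + (j : ℕ) :=
      ⟨α j + j, by push_cast; rfl⟩
    have hkn : k < 2 * b + 2 * m + 1 := by omega
    have hμk := hμ ⟨k, hkn⟩
    rw [dif_neg (by simp only; omega), dif_pos (by simp only; omega)] at hμk
    have hσk := hσ ⟨k, hkn⟩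
    rw [hμk, hρ', hτ] at hσk
    have hs' := (σ ⟨k, hkn⟩).isLt
    simp only at hσk
    have heq : σ ⟨j, by omega⟩ = σ ⟨k, hkn⟩ := Fin.ext (by omega)
    have := congrArg Fin.val (σ.injective heq)
    simp only at this
    omega
  · intro h
    let f : Fin (2 * b + 2 * m + 1) → Fin (2 * b + 2 * m + 1) := fun i =>
      ⟨if (i : ℕ) < b then m + i
        else if (i : ℕ) < b + m then 3 * b + 2 * m - i
        else if (i : ℕ) = b + m then m + b
        else if (i : ℕ) < b + 2 * m + 1 then 2 * m + b - i
        else i - m, by have := i.isLt; split_ifs <;> omega⟩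
    have hf : Function.Injective f := by
      intro i j hij
      have hij' := congrArg Fin.val hij
      have hi := i.isLt
      have hj := j.isLt
      simp only [f] at hij'
      apply Fin.ext
      split_ifs at hij' <;> omega
    refine ⟨Equiv.ofBijective f (Finite.injective_iff_bijective.mp hf), fun i => ?_⟩
    have hi := i.isLt
    rw [Equiv.ofBijective_apply, hτ, hρ', hμ]
    simp only [f, h]
    split_ifs <;> push_cast <;> omega
end

section
/- Let a, b be integers with 1 ≤ a ≤ b and let n = a + b. Define ρ, τ : Fin n → ℚ by ρ_i = a + b − 1/2 − i and τ_i = max(b − a − 1/2 − i, 1/2) for 0 ≤ i ≤ n−1. For a weakly decreasing sequence of natural numbers α₁ ≥ α₂ ≥ ... ≥ α_a ≥ 0, define μ : Fin n → ℚ by μ_{2j−2} = μ_{2j−1} = α_j for 1 ≤ j ≤ a and μ_i = 0 for 2a ≤ i ≤ n−1. Then μ − ρ is signed-permutation-equivalent to τ if and only if α_j = a + b + 1 − 2j for all 1 ≤ j ≤ a. -/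
/-- Two vectors `v, w : Fin n → ℚ` are signed-permutation-equivalent if there are a
permutation `σ` of `Fin n` and signs `ε : Fin n → {1, −1}` with
`v i = ε i * w (σ i)` for all `i`. -/
def SignedPermEquiv {n : ℕ} (v w : Fin n → ℚ) : Prop :=
  ∃ (σ : Equiv.Perm (Fin n)) (ε : Fin n → ℚ),
    (∀ i, ε i = 1 ∨ ε i = -1) ∧ ∀ i, v i = ε i * w (σ i)

/-- The cyclic rotation of `Fin n`, `n = k + m`, sending the first `k` indices behind the
last `m` ones. -/
def rotateBlock (n k m : ℕ) (hn : n = k + m) : Equiv.Perm (Fin n) where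
  toFun i := if h : (i : ℕ) < k then ⟨i + m, by omega⟩ else ⟨i - k, by omega⟩
  invFun i := if h : (i : ℕ) < m then ⟨i + k, by omega⟩ else ⟨i - m, by omega⟩
  left_inv i := by
    ext
    by_cases h : (i : ℕ) < k <;> simp [h] <;> split_ifs <;> simp <;> omega
  right_inv i := by
    ext
    by_cases h : (i : ℕ) < m <;> simp [h] <;> split_ifs <;> simp <;> omega

theorem rotateBlock_of_lt {n k m : ℕ} (hn : n = k + m) {i : Fin n} (h : (i : ℕ) < k) :
    (rotateBlock n k m hn i : ℕ) = i + m := by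
  simp [rotateBlock, h]

theorem rotateBlock_of_le {n k m : ℕ} (hn : n = k + m) {i : Fin n} (h : k ≤ (i : ℕ)) :
    (rotateBlock n k m hn i : ℕ) = i - k := by
  simp [rotateBlock, h.not_gt]

/-- Signed permutations preserve the sum of squares. -/
theorem SignedPermEquiv.sum_sq_eq {n : ℕ} {v w : Fin n → ℚ} (h : SignedPermEquiv v w) :
    ∑ i, v i ^ 2 = ∑ i, w i ^ 2 := by
  obtain ⟨σ, ε, hε, h⟩ := h
  rw [← Equiv.sum_comp σ (fun i => w i ^ 2)]
  refine Finset.sum_congr rfl fun i _ => ?_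
  rcases hε i with hi | hi <;> rw [h i, hi] <;> ring

/-- A half-integer has square at least `1 / 4`. -/
theorem quarter_le_sq_int_add_half (z : ℤ) : (1 / 4 : ℚ) ≤ ((z : ℚ) + 1 / 2) ^ 2 := by
  have h : (0 : ℚ) ≤ (z * (z + 1) : ℤ) := by
    norm_cast
    rcases le_or_gt 0 z with hz | hz <;> nlinarith
  push_cast at h
  nlinarith

/-- Combinatorial core of the computation of the Dirac cohomology of the spherical
unipotent representation of `SO(2n+1, ℂ)` attached to the nilpotent orbit with
columns `2b+1` and `2a`.  Here `ρ` is the half-sum of positive roots of `so(2n+1)`,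
`τ = 2λ − ρ` is the prescribed highest weight of the Dirac cohomology, `μ` ranges
over the highest weights of the `K`-types of the representation, and the Weyl group
of type `B` acts by signed permutations. -/
theorem stmt13 (a b : ℕ) (ha : 1 ≤ a) (hab : a ≤ b) (n : ℕ) (hn : n = a + b)
    (α : Fin a → ℕ) (hα : ∀ i j : Fin a, i ≤ j → α j ≤ α i)
    (ρ τ μ : Fin n → ℚ)
    (hρ : ∀ i : Fin n, ρ i = (a : ℚ) + b - 1/2 - (i : ℕ))
    (hτ : ∀ i : Fin n, τ i = max ((b : ℚ) - a - 1/2 - (i : ℕ)) (1/2))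
    (hμ : ∀ i : Fin n, μ i =
      if h : (i : ℕ) < 2 * a then (α ⟨(i : ℕ) / 2, by omega⟩ : ℚ) else 0) :
    SignedPermEquiv (fun i => μ i - ρ i) τ ↔
      ∀ j : Fin a, (α j : ℚ) = (a : ℚ) + b + 1 - 2 * ((j : ℕ) + 1) := by
  have hn' : n = 2 * a + (b - a) := by omega
  set s := rotateBlock n (2 * a) (b - a) hn' with hs
  have hτ_lt : ∀ i : Fin n, (i : ℕ) < 2 * a → τ (s i) = 1 / 2 := by
    intro i hi
    rw [hτ, hs, rotateBlock_of_lt hn' hi]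
    push_cast [Nat.cast_sub hab]
    apply max_eq_right
    have : (0 : ℚ) ≤ (i : ℕ) := Nat.cast_nonneg _
    linarith
  have hτ_le : ∀ i : Fin n, 2 * a ≤ (i : ℕ) → τ (s i) = ρ i := by
    intro i hi
    have hi' : ((i : ℕ) : ℚ) + 1 ≤ a + b := by
      have := i.isLt
      exact_mod_cast (by omega : (i : ℕ) + 1 ≤ a + b)
    rw [hτ, hρ, hs, rotateBlock_of_le hn' hi, Nat.cast_sub hi]
    push_cast
    rw [max_eq_left] <;> linarith
  have hμ_le : ∀ i : Fin n, 2 * a ≤ (i : ℕ) → μ i = 0 := fun i hi => by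
    rw [hμ, dif_neg hi.not_gt]
  constructor
  · intro h
    have hsum : ∑ i, ((μ i - ρ i) ^ 2 - τ (s i) ^ 2) = 0 := by
      rw [Finset.sum_sub_distrib, h.sum_sq_eq, Equiv.sum_comp s (fun i => τ i ^ 2), sub_self]
    have hnonneg : ∀ i ∈ Finset.univ, 0 ≤ (μ i - ρ i) ^ 2 - τ (s i) ^ 2 := by
      intro i _
      rcases lt_or_ge (i : ℕ) (2 * a) with hi | hi
      · have := quarter_le_sq_int_add_half
          ((α ⟨(i : ℕ) / 2, by omega⟩ : ℤ) - a - b + (i : ℕ))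
        push_cast at this
        rw [hτ_lt i hi, hμ, dif_pos hi, hρ]
        linarith
      · rw [hτ_le i hi, hμ_le i hi]
        linarith
    have hzero := (Finset.sum_eq_zero_iff_of_nonneg hnonneg).1 hsum
    intro j
    have hj := j.isLt
    have h₀ := hzero ⟨2 * j, by omega⟩ (Finset.mem_univ _)
    have h₁ := hzero ⟨2 * j + 1, by omega⟩ (Finset.mem_univ _)
    rw [hτ_lt _ (by simp), hμ, dif_pos (by simp), hρ] at h₀
    rw [hτ_lt _ (by simp; omega), hμ, dif_pos (by simp; omega), hρ] at h₁
    have e : (2 * (j : ℕ) + 1) / 2 = j := by omega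
    simp only [Nat.mul_div_cancel_left _ two_pos, e, Fin.eta] at h₀ h₁
    push_cast at h₀ h₁
    linarith
  · intro h
    refine ⟨s, fun i => if (i : ℕ) < 2 * a ∧ (i : ℕ) % 2 = 1 then 1 else -1, ?_, ?_⟩
    · intro i
      dsimp only
      split_ifs <;> simp
    · intro i
      dsimp only
      rcases lt_or_ge (i : ℕ) (2 * a) with hi | hi
      · have hdiv : (((i : ℕ) : ℚ)) = 2 * ((i : ℕ) / 2 : ℕ) + ((i : ℕ) % 2 : ℕ) := by
          exact_mod_cast (Nat.div_add_mod (i : ℕ) 2).symm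
        rw [hτ_lt i hi, hμ, dif_pos hi, h, hρ]
        dsimp only
        rcases Nat.mod_two_eq_zero_or_one (i : ℕ) with h2 | h2
        · rw [h2] at hdiv
          rw [if_neg (by omega), hdiv]
          push_cast
          ring
        · rw [h2] at hdiv
          rw [if_pos ⟨hi, h2⟩, hdiv]
          push_cast
          ring
      · rw [hτ_le i hi, hμ_le i hi, if_neg (by omega)]
        ring
end
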